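/- arXiv:2208.02434 — 4 statements merged into one kernel-verified Lean document; each statement's English description precedes it below -/
import Mathlib

section
/- Let S and A be finite types. Let μ and ν be probability distributions on S, and for each s ∈ S let π(·|s) and π'(·|s) be probability distributions on A. Define joint distributions on S × A by p(s,a) = μ(s)·π(a|s) and q(s,a) = ν(s)·π'(a|s). Then D_TV(p, q) ≤ D_TV(μ, ν) + ∑_{s∈S} μ(s)·D_TV(π(·|s), π'(·|s)). -/
open Finset

/-- Total variation distance between two (probability) distributions on a finite type. -/
noncomputable def tvDist {X : Type*} [Fintype X] (p q : X → ℝ) : ℝ :=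
  (1 / 2) * ∑ x, |p x - q x|

/-- TV distance between joint state-action distributions is bounded by the
TV distance between the state marginals plus the expected TV distance between policies. -/
theorem tv_joint_le_tv_marginal_add_policy {S A : Type*} [Fintype S] [Fintype A]
    (μ ν : S → ℝ) (π π' : S → A → ℝ)
    (hμ0 : ∀ s, 0 ≤ μ s) (hμ1 : ∑ s, μ s = 1)
    (hν0 : ∀ s, 0 ≤ ν s) (hν1 : ∑ s, ν s = 1)
    (hπ0 : ∀ s a, 0 ≤ π s a) (hπ1 : ∀ s, ∑ a, π s a = 1)
    (hπ'0 : ∀ s a, 0 ≤ π' s a) (hπ'1 : ∀ s, ∑ a, π' s a = 1) :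
    tvDist (fun x : S × A => μ x.1 * π x.1 x.2) (fun x : S × A => ν x.1 * π' x.1 x.2)
      ≤ tvDist μ ν + ∑ s, μ s * tvDist (π s) (π' s) := by
  have key : ∀ s, ∑ a, |μ s * π s a - ν s * π' s a|
      ≤ |μ s - ν s| + μ s * ∑ a, |π s a - π' s a| := fun s => calc
    ∑ a, |μ s * π s a - ν s * π' s a|
        ≤ ∑ a, (|μ s - ν s| * π' s a + μ s * |π s a - π' s a|) := by
      refine sum_le_sum fun a _ => ?_
      calc |μ s * π s a - ν s * π' s a|
          = |(μ s - ν s) * π' s a + μ s * (π s a - π' s a)| := by congr 1; ring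
        _ ≤ |(μ s - ν s) * π' s a| + |μ s * (π s a - π' s a)| := abs_add_le _ _
        _ = |μ s - ν s| * π' s a + μ s * |π s a - π' s a| := by
          rw [abs_mul, abs_mul, abs_of_nonneg (hπ'0 s a), abs_of_nonneg (hμ0 s)]
    _ = |μ s - ν s| + μ s * ∑ a, |π s a - π' s a| := by
      rw [sum_add_distrib, ← mul_sum, ← mul_sum, hπ'1, mul_one]
  have total := sum_le_sum fun s (_ : s ∈ univ) => key s
  rw [sum_add_distrib] at total
  simp only [tvDist, Fintype.sum_prod_type, mul_left_comm (μ _), ← mul_sum]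
  linarith
end

section
/- Let S and A be finite types. Let ρ and ρ' be probability distributions on S × A, and for each (s', a) ∈ S × A let P(·|s',a) and P'(·|s',a) be probability distributions on S. Define the marginal distributions on S by μ(s) = ∑_{(s',a)} P(s|s',a)·ρ(s',a) and ν(s) = ∑_{(s',a)} P'(s|s',a)·ρ'(s',a). Then D_TV(μ, ν) ≤ D_TV(ρ, ρ') + ∑_{(s',a)} ρ'(s',a)·D_TV(P(·|s',a), P'(·|s',a)). -/
open Finset

/-- pushing joint distributions through two backward transition kernels:
the TV distance between the resulting state marginals is bounded by the TV distance
between the joints plus the expected TV distance between the kernels. -/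
theorem tv_pushforward_le {S A : Type*} [Fintype S] [Fintype A]
    (ρ ρ' : S × A → ℝ) (P P' : S × A → S → ℝ)
    (hρ0 : ∀ x, 0 ≤ ρ x) (hρ1 : ∑ x, ρ x = 1)
    (hρ'0 : ∀ x, 0 ≤ ρ' x) (hρ'1 : ∑ x, ρ' x = 1)
    (hP0 : ∀ x s, 0 ≤ P x s) (hP1 : ∀ x, ∑ s, P x s = 1)
    (hP'0 : ∀ x s, 0 ≤ P' x s) (hP'1 : ∀ x, ∑ s, P' x s = 1) :
    tvDist (fun s => ∑ x, P x s * ρ x) (fun s => ∑ x, P' x s * ρ' x)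
      ≤ tvDist ρ ρ' + ∑ x, ρ' x * tvDist (P x) (P' x) := by
  have pointwise (s : S) : |∑ x, P x s * ρ x - ∑ x, P' x s * ρ' x|
      ≤ ∑ x, (P x s * |ρ x - ρ' x| + ρ' x * |P x s - P' x s|) := by
    rw [← Finset.sum_sub_distrib]
    refine (Finset.abs_sum_le_sum_abs _ _).trans (Finset.sum_le_sum fun x _ => ?_)
    calc |P x s * ρ x - P' x s * ρ' x|
        = |P x s * (ρ x - ρ' x) + ρ' x * (P x s - P' x s)| := by congr 1; ring
      _ ≤ |P x s * (ρ x - ρ' x)| + |ρ' x * (P x s - P' x s)| := abs_add_le _ _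
      _ = P x s * |ρ x - ρ' x| + ρ' x * |P x s - P' x s| := by
        rw [abs_mul, abs_mul, abs_of_nonneg (hP0 x s), abs_of_nonneg (hρ'0 x)]
  have summed : ∑ s, |∑ x, P x s * ρ x - ∑ x, P' x s * ρ' x|
      ≤ ∑ x, |ρ x - ρ' x| + ∑ x, ρ' x * ∑ s, |P x s - P' x s| := by
    refine (Finset.sum_le_sum fun s _ => pointwise s).trans_eq ?_
    rw [Finset.sum_comm]
    simp_rw [Finset.sum_add_distrib, ← Finset.sum_mul, ← Finset.mul_sum, hP1, one_mul]
  simp only [tvDist, mul_left_comm _ (1 / 2 : ℝ), ← Finset.mul_sum]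
  linarith
end

section
/- Let S and A be finite types and k_b a natural number. For each t ∈ {0, …, k_b}, let μ_t, μ_t^e be probability distributions on S, let π_t(·|s), π_t^e(·|s) be probability distributions on A for each s ∈ S, and define joints p_t(s,a) = μ_t(s)·π_t(a|s) and p_t^e(s,a) = μ_t^e(s)·π_t^e(a|s). Let P(·|s',a) and P^e(·|s',a) be probability distributions on S for each (s',a) ∈ S × A, and suppose the backward Markov recursions μ_t(s) = ∑_{(s',a)} P(s|s',a)·p_{t+1}(s',a) and μ_t^e(s) = ∑_{(s',a)} P^e(s|s',a)·p_{t+1}^e(s',a) hold for all t < k_b, with μ_{k_b} = μ_{k_b}^e. Assume ε_π ≥ 0 satisfies ∑_{s} μ_t(s)·D_TV(π_t(·|s), π_t^e(·|s)) ≤ ε_π for all t ≤ k_b, and ε_m ≥ 0 satisfies ∑_{(s',a)} p_{t+1}^e(s',a)·D_TV(P(·|s',a), P^e(·|s',a)) ≤ ε_m for all t < k_b. Then for every t ≤ k_b, the state marginals satisfy D_TV(μ_t, μ_t^e) ≤ (k_b − t)·(ε_π + ε_m). -/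
open Finset

/-- Pushing two weights through two Markov kernels increases their total variation distance by at
most the averaged distance between the kernels. -/
theorem tvDist_bind_le {X Y : Type*} [Fintype X] [Fintype Y] (p q : X → ℝ) (K L : X → Y → ℝ)
    (hq : ∀ x, 0 ≤ q x) (hK0 : ∀ x y, 0 ≤ K x y) (hK1 : ∀ x, ∑ y, K x y = 1) :
    tvDist (fun y => ∑ x, K x y * p x) (fun y => ∑ x, L x y * q x) ≤
      tvDist p q + ∑ x, q x * tvDist (K x) (L x) := by
  have key : ∑ y, |∑ x, K x y * p x - ∑ x, L x y * q x| ≤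
      ∑ x, |p x - q x| + ∑ x, q x * ∑ y, |K x y - L x y| :=
    calc ∑ y, |∑ x, K x y * p x - ∑ x, L x y * q x|
        ≤ ∑ y, ∑ x, (K x y * |p x - q x| + q x * |K x y - L x y|) := by
          refine sum_le_sum fun y _ => ?_
          rw [← sum_sub_distrib]
          refine (abs_sum_le_sum_abs _ _).trans (sum_le_sum fun x _ => ?_)
          calc |K x y * p x - L x y * q x|
              = |K x y * (p x - q x) + q x * (K x y - L x y)| := by ring_nf
            _ ≤ |K x y * (p x - q x)| + |q x * (K x y - L x y)| := abs_add_le _ _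
            _ = K x y * |p x - q x| + q x * |K x y - L x y| := by
              rw [abs_mul, abs_mul, abs_of_nonneg (hK0 x y), abs_of_nonneg (hq x)]
      _ = ∑ x, |p x - q x| + ∑ x, q x * ∑ y, |K x y - L x y| := by
          rw [sum_comm]
          simp_rw [sum_add_distrib, ← sum_mul, ← mul_sum, hK1, one_mul]
  have hmean : ∑ x, q x * tvDist (K x) (L x) =
      (1 / 2) * ∑ x, q x * ∑ y, |K x y - L x y| := by
    rw [mul_sum]
    exact sum_congr rfl fun x _ => by rw [tvDist]; ring
  rw [hmean, tvDist, tvDist]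
  linarith

/-- The joint distributions built from two marginals and two conditional kernels differ by at most
the distance of the marginals plus the averaged distance of the kernels. -/
theorem tvDist_joint_le {X Y : Type*} [Fintype X] [Fintype Y] (p q : X → ℝ) (K L : X → Y → ℝ)
    (hp : ∀ x, 0 ≤ p x) (hL0 : ∀ x y, 0 ≤ L x y) (hL1 : ∀ x, ∑ y, L x y = 1) :
    tvDist (fun z : X × Y => p z.1 * K z.1 z.2) (fun z : X × Y => q z.1 * L z.1 z.2) ≤
      tvDist p q + ∑ x, p x * tvDist (K x) (L x) := by
  have key : ∑ z : X × Y, |p z.1 * K z.1 z.2 - q z.1 * L z.1 z.2| ≤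
      ∑ x, |p x - q x| + ∑ x, p x * ∑ y, |K x y - L x y| :=
    calc ∑ z : X × Y, |p z.1 * K z.1 z.2 - q z.1 * L z.1 z.2|
        ≤ ∑ z : X × Y, (L z.1 z.2 * |p z.1 - q z.1| + p z.1 * |K z.1 z.2 - L z.1 z.2|) := by
          refine sum_le_sum fun ⟨x, y⟩ _ => ?_
          calc |p x * K x y - q x * L x y|
              = |L x y * (p x - q x) + p x * (K x y - L x y)| := by ring_nf
            _ ≤ |L x y * (p x - q x)| + |p x * (K x y - L x y)| := abs_add_le _ _
            _ = L x y * |p x - q x| + p x * |K x y - L x y| := by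
              rw [abs_mul, abs_mul, abs_of_nonneg (hL0 x y), abs_of_nonneg (hp x)]
      _ = ∑ x, |p x - q x| + ∑ x, p x * ∑ y, |K x y - L x y| := by
          rw [Fintype.sum_prod_type]
          simp_rw [sum_add_distrib, ← sum_mul, ← mul_sum, hL1, one_mul]
  have hmean : ∑ x, p x * tvDist (K x) (L x) =
      (1 / 2) * ∑ x, p x * ∑ y, |K x y - L x y| := by
    rw [mul_sum]
    exact sum_congr rfl fun x _ => by rw [tvDist]; ring
  rw [hmean, tvDist, tvDist]
  linarith

/-- the state marginals of the two backward rollout processes satisfy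
`D_TV(μ_t, μ_t^e) ≤ (k_b - t) * (ε_π + ε_m)`. -/
theorem marginal_tv_le {S A : Type*} [Fintype S] [Fintype A]
    (kb : ℕ) (μ μe : ℕ → S → ℝ) (π πe : ℕ → S → A → ℝ)
    (P Pe : S × A → S → ℝ) (επ εm : ℝ)
    (hμ0 : ∀ t ≤ kb, ∀ s, 0 ≤ μ t s) (hμ1 : ∀ t ≤ kb, ∑ s, μ t s = 1)
    (hμe0 : ∀ t ≤ kb, ∀ s, 0 ≤ μe t s) (hμe1 : ∀ t ≤ kb, ∑ s, μe t s = 1)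
    (hπ0 : ∀ t ≤ kb, ∀ s a, 0 ≤ π t s a) (hπ1 : ∀ t ≤ kb, ∀ s, ∑ a, π t s a = 1)
    (hπe0 : ∀ t ≤ kb, ∀ s a, 0 ≤ πe t s a) (hπe1 : ∀ t ≤ kb, ∀ s, ∑ a, πe t s a = 1)
    (hP0 : ∀ x s, 0 ≤ P x s) (hP1 : ∀ x, ∑ s, P x s = 1)
    (hPe0 : ∀ x s, 0 ≤ Pe x s) (hPe1 : ∀ x, ∑ s, Pe x s = 1)
    (hrec : ∀ t < kb, ∀ s,
      μ t s = ∑ x : S × A, P x s * (μ (t + 1) x.1 * π (t + 1) x.1 x.2))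
    (hrece : ∀ t < kb, ∀ s,
      μe t s = ∑ x : S × A, Pe x s * (μe (t + 1) x.1 * πe (t + 1) x.1 x.2))
    (hterm : μ kb = μe kb)
    (hεπ : 0 ≤ επ)
    (hπbound : ∀ t ≤ kb, ∑ s, μ t s * tvDist (π t s) (πe t s) ≤ επ)
    (hεm : 0 ≤ εm)
    (hmbound : ∀ t < kb,
      ∑ x : S × A, (μe (t + 1) x.1 * πe (t + 1) x.1 x.2) * tvDist (P x) (Pe x) ≤ εm) :
    ∀ t ≤ kb, tvDist (μ t) (μe t) ≤ ((kb : ℝ) - (t : ℝ)) * (επ + εm) := by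
  intro t ht
  induction ht using Nat.decreasingInduction with
  | self => simp [hterm, tvDist]
  | of_succ t ht ih =>
    have hstep := tvDist_bind_le
      (fun x : S × A => μ (t + 1) x.1 * π (t + 1) x.1 x.2)
      (fun x : S × A => μe (t + 1) x.1 * πe (t + 1) x.1 x.2) P Pe
      (fun x => mul_nonneg (hμe0 _ ht _) (hπe0 _ ht _ _)) hP0 hP1
    rw [← funext (hrec t ht), ← funext (hrece t ht)] at hstep
    have hjoint := tvDist_joint_le (μ (t + 1)) (μe (t + 1)) (π (t + 1)) (πe (t + 1))
      (hμ0 _ ht) (hπe0 _ ht) (hπe1 _ ht)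
    have hπ := hπbound (t + 1) ht
    have hm := hmbound t ht
    push_cast at ih
    linarith
end

section
/- Let S and A be finite types and k_b a natural number. For each t ∈ {0, …, k_b}, let μ_t, μ_t^e be probability distributions on S, let π_t(·|s), π_t^e(·|s) be probability distributions on A for each s ∈ S, and define joints p_t(s,a) = μ_t(s)·π_t(a|s) and p_t^e(s,a) = μ_t^e(s)·π_t^e(a|s). Let P(·|s',a) and P^e(·|s',a) be probability distributions on S for each (s',a) ∈ S × A, and suppose the backward Markov recursions μ_t(s) = ∑_{(s',a)} P(s|s',a)·p_{t+1}(s',a) and μ_t^e(s) = ∑_{(s',a)} P^e(s|s',a)·p_{t+1}^e(s',a) hold for all t < k_b, with μ_{k_b} = μ_{k_b}^e. Assume ε_π ≥ 0 satisfies ∑_{s} μ_t(s)·D_TV(π_t(·|s), π_t^e(·|s)) ≤ ε_π for all t ≤ k_b, and ε_m ≥ 0 satisfies ∑_{(s',a)} p_{t+1}^e(s',a)·D_TV(P(·|s',a), P^e(·|s',a)) ≤ ε_m for all t < k_b. Then for every t ≤ k_b, the joint distributions satisfy D_TV(p_t, p_t^e) ≤ ε_π + (k_b − t)·(ε_π +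 ε_m). -/
open Finset

/-- The total variation distance between two joint distributions is at most the distance between
their marginals plus the averaged distance between their conditionals. -/
theorem tvDist_joint_le_s6 {S A : Type*} [Fintype S] [Fintype A] {μ ν : S → ℝ} {π ρ : S → A → ℝ}
    (hμ : ∀ s, 0 ≤ μ s) (hρ : ∀ s a, 0 ≤ ρ s a) (hρ1 : ∀ s, ∑ a, ρ s a = 1) :
    tvDist (fun x : S × A => μ x.1 * π x.1 x.2) (fun x : S × A => ν x.1 * ρ x.1 x.2)
      ≤ tvDist μ ν + ∑ s, μ s * tvDist (π s) (ρ s) := by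
  have key (s : S) : ∑ a, |μ s * π s a - ν s * ρ s a|
      ≤ |μ s - ν s| + μ s * ∑ a, |π s a - ρ s a| := by
    calc ∑ a, |μ s * π s a - ν s * ρ s a|
        ≤ ∑ a, (|μ s - ν s| * ρ s a + μ s * |π s a - ρ s a|) := by
          refine sum_le_sum fun a _ => ?_
          have h : μ s * π s a - ν s * ρ s a
              = (μ s - ν s) * ρ s a + μ s * (π s a - ρ s a) := by ring
          rw [h]
          refine (abs_add_le _ _).trans_eq ?_
          rw [abs_mul, abs_mul, abs_of_nonneg (hρ s a), abs_of_nonneg (hμ s)]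
      _ = _ := by rw [sum_add_distrib, ← mul_sum, ← mul_sum, hρ1, mul_one]
  have h := sum_le_sum fun s (_ : s ∈ univ) => key s
  rw [sum_add_distrib] at h
  simp only [tvDist, Fintype.sum_prod_type, mul_left_comm _ (1 / 2 : ℝ), ← mul_sum]
  linarith

/-- Pushing distributions `p`, `q` through kernels `P`, `Q` increases the total variation distance
by at most the averaged distance between the kernels. -/
theorem tvDist_kernel_le {X S : Type*} [Fintype X] [Fintype S] {p q : X → ℝ} {P Q : X → S → ℝ}
    (hq : ∀ x, 0 ≤ q x) (hP : ∀ x s, 0 ≤ P x s) (hP1 : ∀ x, ∑ s, P x s = 1) :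
    tvDist (fun s => ∑ x, P x s * p x) (fun s => ∑ x, Q x s * q x)
      ≤ tvDist p q + ∑ x, q x * tvDist (P x) (Q x) := by
  have h : ∑ s, |∑ x, P x s * p x - ∑ x, Q x s * q x|
      ≤ ∑ x, |p x - q x| + ∑ x, q x * ∑ s, |P x s - Q x s| := by
    calc ∑ s, |∑ x, P x s * p x - ∑ x, Q x s * q x|
        ≤ ∑ s, ∑ x, (|p x - q x| * P x s + q x * |P x s - Q x s|) := by
          refine sum_le_sum fun s _ => ?_
          rw [← sum_sub_distrib]
          refine (abs_sum_le_sum_abs _ _).trans (sum_le_sum fun x _ => ?_)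
          have h : P x s * p x - Q x s * q x
              = (p x - q x) * P x s + q x * (P x s - Q x s) := by ring
          rw [h]
          refine (abs_add_le _ _).trans_eq ?_
          rw [abs_mul, abs_mul, abs_of_nonneg (hP x s), abs_of_nonneg (hq x)]
      _ = _ := by
          rw [sum_comm]
          simp only [sum_add_distrib, ← mul_sum, hP1, mul_one]
  simp only [tvDist, mul_left_comm _ (1 / 2 : ℝ), ← mul_sum]
  linarith

/-- the joint state-action occupancy measures of the two backward rollout
processes satisfy `D_TV(p_t, p_t^e) ≤ ε_π + (k_b - t) * (ε_π + ε_m)`. -/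
theorem joint_tv_le {S A : Type*} [Fintype S] [Fintype A]
    (kb : ℕ) (μ μe : ℕ → S → ℝ) (π πe : ℕ → S → A → ℝ)
    (P Pe : S × A → S → ℝ) (επ εm : ℝ)
    (hμ0 : ∀ t ≤ kb, ∀ s, 0 ≤ μ t s) (hμ1 : ∀ t ≤ kb, ∑ s, μ t s = 1)
    (hμe0 : ∀ t ≤ kb, ∀ s, 0 ≤ μe t s) (hμe1 : ∀ t ≤ kb, ∑ s, μe t s = 1)
    (hπ0 : ∀ t ≤ kb, ∀ s a, 0 ≤ π t s a) (hπ1 : ∀ t ≤ kb, ∀ s, ∑ a, π t s a = 1)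
    (hπe0 : ∀ t ≤ kb, ∀ s a, 0 ≤ πe t s a) (hπe1 : ∀ t ≤ kb, ∀ s, ∑ a, πe t s a = 1)
    (hP0 : ∀ x s, 0 ≤ P x s) (hP1 : ∀ x, ∑ s, P x s = 1)
    (hPe0 : ∀ x s, 0 ≤ Pe x s) (hPe1 : ∀ x, ∑ s, Pe x s = 1)
    (hrec : ∀ t < kb, ∀ s,
      μ t s = ∑ x : S × A, P x s * (μ (t + 1) x.1 * π (t + 1) x.1 x.2))
    (hrece : ∀ t < kb, ∀ s,
      μe t s = ∑ x : S × A, Pe x s * (μe (t + 1) x.1 * πe (t + 1) x.1 x.2))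
    (hterm : μ kb = μe kb)
    (hεπ : 0 ≤ επ)
    (hπbound : ∀ t ≤ kb, ∑ s, μ t s * tvDist (π t s) (πe t s) ≤ επ)
    (hεm : 0 ≤ εm)
    (hmbound : ∀ t < kb,
      ∑ x : S × A, (μe (t + 1) x.1 * πe (t + 1) x.1 x.2) * tvDist (P x) (Pe x) ≤ εm) :
    ∀ t ≤ kb,
      tvDist (fun x : S × A => μ t x.1 * π t x.1 x.2)
          (fun x : S × A => μe t x.1 * πe t x.1 x.2)
        ≤ επ + ((kb : ℝ) - (t : ℝ)) * (επ + εm) := by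
  have joint (t : ℕ) (ht : t ≤ kb) :
      tvDist (fun x : S × A => μ t x.1 * π t x.1 x.2) (fun x : S × A => μe t x.1 * πe t x.1 x.2)
        ≤ tvDist (μ t) (μe t) + επ :=
    (tvDist_joint_le_s6 (hμ0 t ht) (hπe0 t ht) (hπe1 t ht)).trans
      (add_le_add_right (hπbound t ht) _)
  have marginal (t : ℕ) (ht : t ≤ kb) :
      tvDist (μ t) (μe t) ≤ ((kb : ℝ) - (t : ℝ)) * (επ + εm) := by
    induction ht using Nat.decreasingInduction with
    | self => simp [hterm, tvDist]
    | of_succ t ht ih =>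
      have hstep := tvDist_kernel_le (p := fun x : S × A => μ (t + 1) x.1 * π (t + 1) x.1 x.2)
        (q := fun x : S × A => μe (t + 1) x.1 * πe (t + 1) x.1 x.2) (P := P) (Q := Pe)
        (fun x => mul_nonneg (hμe0 _ ht _) (hπe0 _ ht _ _)) hP0 hP1
      rw [← funext (hrec t ht), ← funext (hrece t ht)] at hstep
      have hjoint := joint (t + 1) ht
      have hm := hmbound t ht
      push_cast at ih
      linarith
  intro t ht
  linarith [joint t ht, marginal t ht]
end
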